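/- Let (Ω, P) be a probability space, let C ≥ 2 be a natural number, let Y : Ω → Fin C be uniformly distributed on the C classes, let B : Ω → ℬ be a random variable taking values in a finite set ℬ (the GSL bases), let φ : ℬ → ℬ' be any function into a finite set ℬ' (the aggregation over a new graph structure constructed non-parametrically from B), and let cls : ℬ' → Fin C be any function (classifier). Define the accuracy P_A = P(cls(φ(B)) = Y) and I(X;Z) = Σ_{x,z} p(x,z) · log( p(x,z)/(p(x)p(z)) ) with natural logarithm. Then P_A ≤ (I(Y;B) + log 2)/log C. -/

import Mathlib

open MeasureTheory Real

/-- Joint probability mass function `p(x,z)` of two finitely-valued random variables. -/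
noncomputable def jointPMF {Ω : Type*} [MeasurableSpace Ω] (P : Measure Ω)
    {α β : Type*} (X : Ω → α) (Z : Ω → β) (x : α) (z : β) : ℝ :=
  (P {ω | X ω = x ∧ Z ω = z}).toReal

/-- Marginal probability mass function `p(x)` of a finitely-valued random variable. -/
noncomputable def margPMF {Ω : Type*} [MeasurableSpace Ω] (P : Measure Ω)
    {α : Type*} (X : Ω → α) (x : α) : ℝ :=
  (P {ω | X ω = x}).toReal

/-- Mutual information `I(X;Z) = Σ_{x,z} p(x,z) log( p(x,z) / (p(x) p(z)) )`
(natural logarithm) of two finitely-valued random variables. -/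
noncomputable def mutualInfo {Ω : Type*} [MeasurableSpace Ω] (P : Measure Ω)
    {α β : Type*} [Fintype α] [Fintype β] (X : Ω → α) (Z : Ω → β) : ℝ :=
  ∑ x : α, ∑ z : β, jointPMF P X Z x z *
    Real.log (jointPMF P X Z x z / (margPMF P X x * margPMF P Z z))

/-- The measure of a set is the sum of its measures on the fibres of a finitely-valued random
variable. -/
lemma measureReal_eq_sum_inter_fiber {Ω β : Type*} [MeasurableSpace Ω] (P : Measure Ω)
    [IsFiniteMeasure P] [Fintype β] [MeasurableSpace β] [MeasurableSingletonClass β]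
    {Z : Ω → β} (hZ : Measurable Z) (S : Set Ω) :
    P.real S = ∑ z, P.real {ω | ω ∈ S ∧ Z ω = z} := by
  have hfib : ∀ z, MeasurableSet (Z ⁻¹' {z}) := fun z => hZ (measurableSet_singleton z)
  have h := sum_measureReal_preimage_singleton (μ := P.restrict S) Finset.univ
    (f := Z) (fun z _ => hfib z)
  rw [Finset.coe_univ, Set.preimage_univ, measureReal_restrict_apply_univ] at h
  rw [← h]
  refine Finset.sum_congr rfl fun z _ => ?_
  rw [measureReal_restrict_apply (hfib z)]
  congr 1
  ext ω
  exact and_comm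

/-- Pointwise Gibbs inequality, comparing `p` with the competitor `m * q`. -/
lemma mul_log_add_sub_le_mul_log_div {p m q c : ℝ} (hp : 0 ≤ p) (hpm : p ≤ m) (hq : 0 < q)
    (hc : 0 < c) :
    p * log (c * q) + (p - m * q) ≤ p * log (p / (1 / c * m)) := by
  rcases hp.eq_or_lt with rfl | hp
  · simpa using mul_nonneg hpm hq.le
  have hm : 0 < m := hp.trans_le hpm
  have hlog : log (p / (1 / c * m)) = log (c * q) - log (m * q / p) := by
    rw [← log_div (by positivity) (by positivity)]
    congr 1
    field_simp
  have hle : p * log (m * q / p) ≤ m * q - p := by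
    calc p * log (m * q / p) ≤ p * (m * q / p - 1) := by
          gcongr
          exact log_le_sub_one_of_pos (by positivity)
      _ = m * q - p := by field_simp
  rw [hlog]
  linarith

/-- **Fano-type inequality** for a joint mass function `a` whose first marginal is uniform on `C`
classes. -/
lemma sum_mul_log_sub_log_two_le {β : Type*} [Fintype β] {C : ℕ} (hC : 0 < C)
    (a : Fin C → β → ℝ) (m : β → ℝ) (g : β → Fin C) (ha : ∀ y b, 0 ≤ a y b)
    (hm : ∀ b, m b = ∑ y, a y b) (hsum : ∑ b, m b = 1) :
    (∑ b, a (g b) b) * log C - log 2 ≤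
      ∑ y, ∑ b, a y b * log (a y b / (1 / C * m b)) := by
  have hC' : (0 : ℝ) < C := by exact_mod_cast hC
  have hm0 : ∀ b, 0 ≤ m b := fun b => hm b ▸ Finset.sum_nonneg fun y _ => ha y b
  let q : Fin C → β → ℝ := fun y b => if y = g b then 1 / 2 else 1 / (2 * C)
  have hq : ∀ y b, 0 < q y b := fun y b => by
    dsimp only [q]
    split_ifs <;> positivity
  have hqlog : ∀ y b, a y b * log (C * q y b) =
      (if y = g b then a y b * log C else 0) - a y b * log 2 := fun y b => by
    dsimp only [q]
    split_ifs
    · rw [mul_one_div, log_div hC'.ne' two_ne_zero, mul_sub]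
    · rw [show (C : ℝ) * (1 / (2 * C)) = 2⁻¹ by field_simp, log_inv]
      ring
  have hqsum : ∀ b, ∑ y, q y b ≤ 1 := fun b => by
    calc ∑ y, q y b ≤ ∑ y, ((if y = g b then 1 / 2 else 0) + 1 / (2 * (C : ℝ))) := by
          refine Finset.sum_le_sum fun y _ => ?_
          dsimp only [q]
          have : (0 : ℝ) < 1 / (2 * C) := by positivity
          split_ifs <;> linarith
      _ = 1 := by
          rw [Finset.sum_add_distrib, Finset.sum_ite_eq' Finset.univ (g b)]
          simp only [Finset.mem_univ, if_true, Finset.sum_const, Finset.card_univ,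
            Fintype.card_fin, nsmul_eq_mul]
          field_simp
          norm_num
  rw [Finset.sum_comm]
  calc (∑ b, a (g b) b) * log C - log 2
      = ∑ b, (a (g b) b * log C - m b * log 2) := by
        rw [Finset.sum_sub_distrib, ← Finset.sum_mul, ← Finset.sum_mul, hsum, one_mul]
    _ ≤ ∑ b, ∑ y, (a y b * log (C * q y b) + (a y b - m b * q y b)) := by
        refine Finset.sum_le_sum fun b _ => ?_
        simp only [hqlog, Finset.sum_add_distrib, Finset.sum_sub_distrib, ← Finset.sum_mul,
          ← Finset.mul_sum, ← hm, Finset.sum_ite_eq', Finset.mem_univ, if_true]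
        have := mul_le_of_le_one_right (hm0 b) (hqsum b)
        linarith
    _ ≤ ∑ b, ∑ y, a y b * log (a y b / (1 / C * m b)) := by
        refine Finset.sum_le_sum fun b _ => Finset.sum_le_sum fun y _ => ?_
        refine mul_log_add_sub_le_mul_log_div (ha y b) ?_ (hq y b) hC'
        rw [hm b]
        exact Finset.single_le_sum (fun y _ => ha y b) (Finset.mem_univ y)

/-- **Theorems 1 + 2 combined.** The accuracy of any classifier applied to `φ(B)`,
where `φ` is aggregation over a GSL-constructed graph built from the bases `B`, is
bounded by `(I(Y;B) + log 2)/log C` for a uniformly distributed `C`-class label. -/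
theorem gsl_accuracy_le_bases_mutualInfo_bound
    {Ω ℬ ℬ' : Type*} [MeasurableSpace Ω] (P : Measure Ω) [IsProbabilityMeasure P]
    [Fintype ℬ] [MeasurableSpace ℬ] [MeasurableSingletonClass ℬ]
    [Fintype ℬ']
    (C : ℕ) (hC : 2 ≤ C)
    (Y : Ω → Fin C) (B : Ω → ℬ) (φ : ℬ → ℬ') (cls : ℬ' → Fin C)
    (hY : Measurable Y) (hB : Measurable B)
    (hunif : ∀ y : Fin C, P {ω | Y ω = y} = 1 / C) :
    (P {ω | cls (φ (B ω)) = Y ω}).toReal ≤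
      (mutualInfo P Y B + Real.log 2) / Real.log C := by
  have hlogC : 0 < log C := log_pos (by exact_mod_cast hC)
  have hmargY : ∀ y, margPMF P Y y = 1 / C := fun y => by
    simp [margPMF, hunif]
  have hmargB : ∀ b, margPMF P B b = ∑ y, jointPMF P Y B y b := fun b => by
    refine (measureReal_eq_sum_inter_fiber P hY {ω | B ω = b}).trans ?_
    refine Finset.sum_congr rfl fun y _ => ?_
    simp only [jointPMF, Measure.real, Set.mem_ofPred_eq, and_comm]
  have htotal : ∑ b, margPMF P B b = 1 := by
    have h := measureReal_eq_sum_inter_fiber P hB Set.univ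
    simp only [Set.mem_univ, true_and, probReal_univ] at h
    exact h.symm
  have hacc : (P {ω | cls (φ (B ω)) = Y ω}).toReal =
      ∑ b, jointPMF P Y B (cls (φ b)) b := by
    refine (measureReal_eq_sum_inter_fiber P hB _).trans ?_
    refine Finset.sum_congr rfl fun b _ => ?_
    unfold jointPMF Measure.real
    congr 2
    ext ω
    constructor
    · rintro ⟨h, rfl⟩
      exact ⟨h.symm, rfl⟩
    · rintro ⟨h, rfl⟩
      exact ⟨h.symm, rfl⟩
  have hfano := sum_mul_log_sub_log_two_le (by omega) (jointPMF P Y B) (margPMF P B)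
    (fun b => cls (φ b)) (fun _ _ => ENNReal.toReal_nonneg) hmargB htotal
  rw [le_div_iff₀ hlogC, hacc]
  simp only [mutualInfo, hmargY]
  linarith
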